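/- The graded vector space U = ⊕_{d<h−2} HH^0(A)(d)[2] has Hilbert series h_U(t) = ∑_{i=0}^{n−1} t^{2i}, i.e. U is n-dimensional with exactly one basis element in each even degree 0, 2, …, 2(n−1). -/

import Mathlib

/-!
STATEMENT 0. Let `A = Π_{T_n}` be the preprojective algebra of the quiver of type `T_n`
(vertices `0, …, n-1`, arrows `a i : i → i+1`, reversed arrows `a* i`, and a loop `b` at the
last vertex), i.e. the quotient of the path algebra of the double quiver by the relation
`∑ [a, a*] = b²`, graded with all arrows in degree `1`; `h = 2n+1`.

`HH^0(A)` is the center of `A`, with its induced grading.  The graded space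
`U = ⊕_{d < h-2} HH^0(A)(d)[2]` (the below-top-degree part of the center) has Hilbert series
`∑_{i=0}^{n-1} t^{2i}`: it has exactly one basis element in each even degree
`0, 2, …, 2(n-1)` and nothing in odd degrees.
-/

/-- Generators of the path algebra of the double of the `T_n` quiver:
idempotents `e i`, arrows `a i : i → i+1`, reversed arrows `astar i : i+1 → i`,
and the loop `b` at the last vertex. -/
inductive TGen (n : ℕ) : Type
  | e : Fin n → TGen n
  | a : Fin n → TGen n
  | astar : Fin n → TGen n
  | b : TGen n

namespace TPre

open FreeAlgebra

/-- The free algebra on the generators. -/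
abbrev F (n : ℕ) := FreeAlgebra ℂ (TGen n)

/-- Generator inclusion. -/
def g {n : ℕ} (x : TGen n) : F n := FreeAlgebra.ι ℂ x

/-- The defining relations of the preprojective algebra `Π_{T_n}`:
the `e i` are orthogonal idempotents summing to `1`, the arrows are compatible with
source and target idempotents (arrows `a i`, `astar i` with `i+1 = n` are spurious
generators which are set to `0`), the loop `b` sits at the last vertex, and the
preprojective relation `∑_{a ∈ Q'} [a, a*] = b²` holds. -/
inductive TRel (n : ℕ) : F n → F n → Prop
  | idem (i j : Fin n) : TRel n (g (.e i) * g (.e j)) (if i = j then g (.e i) else 0)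
  | sum_idem : TRel n (∑ i : Fin n, g (.e i)) 1
  | a_path (i : Fin n) (h : (i : ℕ) + 1 < n) :
      TRel n (g (.e ⟨(i : ℕ) + 1, h⟩) * g (.a i) * g (.e i)) (g (.a i))
  | a_junk (i : Fin n) (h : ¬ (i : ℕ) + 1 < n) : TRel n (g (.a i)) 0
  | astar_path (i : Fin n) (h : (i : ℕ) + 1 < n) :
      TRel n (g (.e i) * g (.astar i) * g (.e ⟨(i : ℕ) + 1, h⟩)) (g (.astar i))
  | astar_junk (i : Fin n) (h : ¬ (i : ℕ) + 1 < n) : TRel n (g (.astar i)) 0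
  | b_path (i : Fin n) (h : (i : ℕ) + 1 = n) :
      TRel n (g (.e i) * g .b * g (.e i)) (g .b)
  | preproj :
      TRel n (∑ i : Fin n, (g (.a i) * g (.astar i) - g (.astar i) * g (.a i)))
        (g .b * g .b)

/-- The preprojective algebra `A = Π_{T_n}` over `ℂ`. -/
abbrev PiT (n : ℕ) := RingQuot (TRel n)

/-- The image of a generator in `Π_{T_n}`. -/
def gen {n : ℕ} (x : TGen n) : PiT n := RingQuot.mkAlgHom ℂ (TRel n) (g x)

/-- The weight of a generator: trivial paths have degree `0`, arrows degree `1`. -/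
def wt {n : ℕ} : TGen n → ℕ
  | .e _ => 0
  | _ => 1

/-- The degree-`d` homogeneous component of `Π_{T_n}` (for the grading with all arrows
in degree `1`): the span of all products of generators of total weight `d`. -/
def adeg (n d : ℕ) : Submodule ℂ (PiT n) :=
  Submodule.span ℂ {x | ∃ l : List (TGen n), (l.map wt).sum = d ∧ x = (l.map gen).prod}

end TPre

open TPre

namespace TPre

lemma gen_idem {n : ℕ} (i j : Fin n) :
    gen (.e i) * gen (.e j) = if i = j then gen (.e i) else (0 : PiT n) := by
  have h := RingQuot.mkAlgHom_rel ℂ (TRel.idem i j)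
  split_ifs at h ⊢ with hij <;> simpa [gen] using h

lemma gen_sum {n : ℕ} : ∑ i : Fin n, gen (.e i) = (1 : PiT n) := by
  have h := RingQuot.mkAlgHom_rel ℂ (TRel.sum_idem (n := n))
  simpa [gen] using h

lemma gen_a_path {n : ℕ} (i : Fin n) (h : (i : ℕ) + 1 < n) :
    gen (.e ⟨(i : ℕ) + 1, h⟩) * gen (.a i) * gen (.e i) = (gen (.a i) : PiT n) := by
  have h := RingQuot.mkAlgHom_rel ℂ (TRel.a_path i h)
  simpa [gen] using h

lemma gen_a_junk {n : ℕ} (i : Fin n) (h : ¬ (i : ℕ) + 1 < n) :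
    (gen (.a i) : PiT n) = 0 := by
  have h := RingQuot.mkAlgHom_rel ℂ (TRel.a_junk i h)
  simpa [gen] using h

lemma gen_astar_path {n : ℕ} (i : Fin n) (h : (i : ℕ) + 1 < n) :
    gen (.e i) * gen (.astar i) * gen (.e ⟨(i : ℕ) + 1, h⟩) = (gen (.astar i) : PiT n) := by
  have h := RingQuot.mkAlgHom_rel ℂ (TRel.astar_path i h)
  simpa [gen] using h

lemma gen_astar_junk {n : ℕ} (i : Fin n) (h : ¬ (i : ℕ) + 1 < n) :
    (gen (.astar i) : PiT n) = 0 := by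
  have h := RingQuot.mkAlgHom_rel ℂ (TRel.astar_junk i h)
  simpa [gen] using h

lemma gen_b_path {n : ℕ} (i : Fin n) (h : (i : ℕ) + 1 = n) :
    gen (.e i) * gen .b * gen (.e i) = (gen .b : PiT n) := by
  have h := RingQuot.mkAlgHom_rel ℂ (TRel.b_path i h)
  simpa [gen] using h

lemma gen_preproj {n : ℕ} :
    ∑ i : Fin n, (gen (.a i) * gen (.astar i) - gen (.astar i) * gen (.a i))
      = (gen .b * gen .b : PiT n) := by
  have h := RingQuot.mkAlgHom_rel ℂ (TRel.preproj (n := n))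
  simpa [gen] using h

/-- Idempotents indexed by natural numbers (zero outside the vertex set). -/
noncomputable def E (n i : ℕ) : PiT n := if h : i < n then gen (.e ⟨i, h⟩) else 0
/-- Sum of all arrows going up. -/
noncomputable def up (n : ℕ) : PiT n := ∑ i : Fin n, gen (.a i)
/-- Sum of all arrows going down. -/
noncomputable def dn (n : ℕ) : PiT n := ∑ i : Fin n, gen (.astar i)
/-- The loop. -/
noncomputable def bb (n : ℕ) : PiT n := gen .b
/-- The central element of degree two. -/
noncomputable def xx (n : ℕ) : PiT n := up n * dn n

lemma E_of_le {n i : ℕ} (h : n ≤ i) : E n i = 0 := by simp [E, not_lt.2 h]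

lemma E_fin {n : ℕ} (i : Fin n) : E n i = gen (.e i) := by simp [E]

lemma E_mul {n : ℕ} (i j : ℕ) : E n i * E n j = if i = j then E n i else 0 := by
  by_cases hi : i < n
  · by_cases hj : j < n
    · simp [E, hi, hj, gen_idem]
    · have : i ≠ j := by omega
      simp [E, hj, this]
  · simp [E, hi]

lemma E_self {n : ℕ} (i : ℕ) : E n i * E n i = E n i := by simp [E_mul]

lemma E_ne {n : ℕ} {i j : ℕ} (h : i ≠ j) : E n i * E n j = 0 := by simp [E_mul, h]

lemma E_sum {n : ℕ} : ∑ i ∈ Finset.range n, E n i = 1 := by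
  rw [Finset.sum_range]; simp [E_fin, gen_sum]

lemma gen_a_E {n : ℕ} (i : Fin n) (j : ℕ) :
    gen (.a i) * E n j = if j = i then gen (.a i) else 0 := by
  by_cases h : (i : ℕ) + 1 < n
  · rw [← gen_a_path i h, mul_assoc, ← E_fin i, E_mul]
    split_ifs <;> first | omega | simp
  · simp [gen_a_junk i h]

lemma E_gen_a {n : ℕ} (i : Fin n) (j : ℕ) :
    E n j * gen (.a i) = if j = i + 1 then gen (.a i) else 0 := by
  by_cases h : (i : ℕ) + 1 < n
  · rw [← gen_a_path i h, ← E_fin ⟨_, h⟩, ← mul_assoc, ← mul_assoc, E_mul]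
    split_ifs <;> simp_all
  · simp [gen_a_junk i h]

lemma gen_s_E {n : ℕ} (i : Fin n) (j : ℕ) :
    gen (.astar i) * E n j = if j = i + 1 then gen (.astar i) else 0 := by
  by_cases h : (i : ℕ) + 1 < n
  · rw [← gen_astar_path i h, mul_assoc, ← E_fin ⟨_, h⟩, E_mul]
    split_ifs <;> simp_all
  · simp [gen_astar_junk i h]

lemma E_gen_s {n : ℕ} (i : Fin n) (j : ℕ) :
    E n j * gen (.astar i) = if j = i then gen (.astar i) else 0 := by
  by_cases h : (i : ℕ) + 1 < n
  · rw [← gen_astar_path i h, ← E_fin i, ← mul_assoc, ← mul_assoc, E_mul]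
    split_ifs <;> simp_all
  · simp [gen_astar_junk i h]

lemma bb_E {n : ℕ} (hn : 1 ≤ n) (j : ℕ) :
    bb n * E n j = if j + 1 = n then bb n else 0 := by
  have h : ((⟨n - 1, by omega⟩ : Fin n) : ℕ) + 1 = n := by simp; omega
  rw [bb, ← gen_b_path _ h, mul_assoc, ← E_fin, E_mul]
  split_ifs <;> first | simp at *; omega | simp

lemma E_bb {n : ℕ} (hn : 1 ≤ n) (j : ℕ) :
    E n j * bb n = if j + 1 = n then bb n else 0 := by
  have h : ((⟨n - 1, by omega⟩ : Fin n) : ℕ) + 1 = n := by simp; omega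
  rw [bb, ← gen_b_path _ h, ← mul_assoc, ← mul_assoc, ← E_fin, E_mul]
  split_ifs <;> first | simp at *; omega | simp_all

lemma up_E {n : ℕ} (i : Fin n) : up n * E n i = gen (.a i) := by
  simp [up, Finset.sum_mul, gen_a_E, ← Fin.ext_iff]

lemma E_up {n : ℕ} (i : Fin n) : E n (i + 1) * up n = gen (.a i) := by
  simp [up, Finset.mul_sum, E_gen_a, ← Fin.ext_iff]

lemma up_E' {n : ℕ} (i : ℕ) : up n * E n i = E n (i + 1) * up n := by
  by_cases h : i < n
  · rw [up_E ⟨i, h⟩, ← E_up ⟨i, h⟩]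
  · rw [E_of_le (by omega), E_of_le (by omega)]; simp

lemma E_zero_up {n : ℕ} : E n 0 * up n = 0 := by
  simp [up, Finset.mul_sum, E_gen_a]

lemma E_dn {n : ℕ} (i : Fin n) : E n i * dn n = gen (.astar i) := by
  simp [dn, Finset.mul_sum, E_gen_s, ← Fin.ext_iff]

lemma dn_E {n : ℕ} (i : Fin n) : dn n * E n (i + 1) = gen (.astar i) := by
  simp [dn, Finset.sum_mul, gen_s_E, ← Fin.ext_iff]

lemma dn_E' {n : ℕ} (i : ℕ) : dn n * E n (i + 1) = E n i * dn n := by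
  by_cases h : i < n
  · rw [dn_E ⟨i, h⟩, ← E_dn ⟨i, h⟩]
  · rw [E_of_le (by omega), E_of_le (by omega)]; simp

lemma dn_E_zero {n : ℕ} : dn n * E n 0 = 0 := by
  simp [dn, Finset.sum_mul, gen_s_E]

lemma up_bb {n : ℕ} (hn : 1 ≤ n) : up n * bb n = 0 := by
  have h : bb n = E n (n - 1) * bb n := by rw [E_bb hn, if_pos (by omega)]
  rw [h, ← mul_assoc, up_E', E_of_le (by omega)]; simp

lemma bb_dn {n : ℕ} (hn : 1 ≤ n) : bb n * dn n = 0 := by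
  have h : bb n = bb n * E n (n - 1) := by rw [bb_E hn, if_pos (by omega)]
  rw [h, mul_assoc, ← dn_E', E_of_le (by omega)]; simp

lemma pre {n : ℕ} : up n * dn n = dn n * up n + bb n * bb n := by
  rw [bb, ← gen_preproj, Finset.sum_sub_distrib]
  have h1 : up n * dn n = ∑ i : Fin n, gen (.a i) * gen (.astar i) := by
    conv_lhs => rw [dn, Finset.mul_sum]
    refine Finset.sum_congr rfl fun i _ => ?_
    have : (gen (.astar i) : PiT n) = E n i * gen (.astar i) := by simp [E_gen_s]
    rw [this, ← mul_assoc, up_E, ← mul_assoc, gen_a_E]; simp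
  have h2 : dn n * up n = ∑ i : Fin n, gen (.astar i) * gen (.a i) := by
    conv_lhs => rw [up, Finset.mul_sum]
    refine Finset.sum_congr rfl fun i _ => ?_
    have : (gen (.a i) : PiT n) = E n (i+1) * gen (.a i) := by simp [E_gen_a]
    rw [this, ← mul_assoc, dn_E, ← mul_assoc, gen_s_E]; simp
  rw [h1, h2]; abel

lemma xx_up {n : ℕ} (hn : 1 ≤ n) : Commute (xx n) (up n) := by
  unfold xx Commute SemiconjBy
  conv_rhs => rw [pre, mul_add, ← mul_assoc, ← mul_assoc (up n) (bb n), up_bb hn]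
  simp

lemma xx_dn {n : ℕ} (hn : 1 ≤ n) : Commute (xx n) (dn n) := by
  unfold xx Commute SemiconjBy
  conv_lhs => rw [pre, add_mul, mul_assoc (bb n), bb_dn hn, mul_zero, add_zero]
  rw [mul_assoc]

lemma xx_bb {n : ℕ} (hn : 1 ≤ n) : Commute (xx n) (bb n) := by
  unfold xx Commute SemiconjBy
  rw [pre, add_mul, mul_add, mul_assoc, up_bb hn, ← mul_assoc (bb n) (dn n), bb_dn hn, mul_assoc]
  simp

lemma xx_E {n : ℕ} (i : ℕ) : Commute (xx n) (E n i) := by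
  unfold xx Commute SemiconjBy
  rcases i with _ | i
  · rw [mul_assoc, dn_E_zero, ← mul_assoc, E_zero_up]; simp
  · rw [mul_assoc, dn_E', ← mul_assoc, up_E', mul_assoc]

lemma gen_a_eq {n : ℕ} (i : Fin n) : gen (.a i) = up n * E n i := (up_E i).symm
lemma gen_s_eq {n : ℕ} (i : Fin n) : gen (.astar i) = dn n * E n (i + 1) := (dn_E i).symm

lemma xx_gen {n : ℕ} (hn : 1 ≤ n) (t : TGen n) : Commute (xx n) (gen t) := by
  cases t with
  | e i => rw [← E_fin]; exact xx_E _
  | a i => rw [gen_a_eq]; exact (xx_up hn).mul_right (xx_E _)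
  | astar i => rw [gen_s_eq]; exact (xx_dn hn).mul_right (xx_E _)
  | b => exact xx_bb hn

lemma bb_sq {n : ℕ} (hn : 1 ≤ n) : bb n * bb n = xx n * E n (n - 1) := by
  rw [xx, pre, add_mul, mul_assoc, up_E', E_of_le (by omega), mul_assoc (bb n), bb_E hn,
    if_pos (by omega)]
  simp

/-- Induction principle. -/
lemma PiT_induction {n : ℕ} {C : PiT n → Prop} (hc : ∀ r : ℂ, C (algebraMap ℂ _ r))
    (hg : ∀ t, C (gen t)) (hm : ∀ x y, C x → C y → C (x * y))
    (ha : ∀ x y, C x → C y → C (x + y)) (z : PiT n) : C z := by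
  obtain ⟨w, rfl⟩ := RingQuot.mkAlgHom_surjective ℂ (TRel n) z
  induction w using FreeAlgebra.induction with
  | grade0 r => rw [AlgHom.commutes]; exact hc r
  | grade1 x => exact hg x
  | mul a b h1 h2 => rw [map_mul]; exact hm _ _ h1 h2
  | add a b h1 h2 => rw [map_add]; exact ha _ _ h1 h2

lemma xx_comm {n : ℕ} (hn : 1 ≤ n) (z : PiT n) : Commute (xx n) z := by
  induction z using PiT_induction with
  | hc r => exact (Algebra.commutes r _).symm
  | hg t => exact xx_gen hn t
  | hm x y h1 h2 => exact h1.mul_right h2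
  | ha x y h1 h2 => exact h1.add_right h2

/-- Support of the projective module `A e_j` : position `i`, degree `d`. -/
def V (n j i d : ℤ) : Prop :=
  0 ≤ i ∧ i < n ∧
  (((d + i + j) % 2 = 0 ∧ i - j ≤ d ∧ j - i ≤ d ∧ d ≤ i + j) ∨
   ((d + i + j) % 2 = 1 ∧ 2 * n - 1 - i - j ≤ d ∧ d ≤ 2 * n - 1 - (i - j) ∧
      d ≤ 2 * n - 1 - (j - i)))

instance (n j i d : ℤ) : Decidable (V n j i d) := by unfold V; infer_instance

/-- Elementary operator moving position `q` to position `p`, raising the degree by one. -/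
def mv (n j p q : ℕ) : Module.End ℂ (ℕ → ℤ → ℂ) where
  toFun f r d := if r = p ∧ V n j p d ∧ V n j q (d - 1) then f q (d - 1) else 0
  map_add' f g := by ext r d; simp only [Pi.add_apply]; split_ifs <;> simp
  map_smul' c f := by ext r d; simp only [Pi.smul_apply, RingHom.id_apply]; split_ifs <;> simp

/-- Projection operator. -/
def pj (n i : ℕ) : Module.End ℂ (ℕ → ℤ → ℂ) where
  toFun f r d := if r = i ∨ (n ≤ r ∧ i = 0) then f r d else 0
  map_add' f g := by ext r d; simp only [Pi.add_apply]; split_ifs <;> simp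
  map_smul' c f := by ext r d; simp only [Pi.smul_apply, RingHom.id_apply]; split_ifs <;> simp

lemma mv_apply (n j p q : ℕ) (f : ℕ → ℤ → ℂ) (r : ℕ) (d : ℤ) :
    mv n j p q f r d = if r = p ∧ V n j p d ∧ V n j q (d - 1) then f q (d - 1) else 0 := rfl

lemma pj_apply (n i : ℕ) (f : ℕ → ℤ → ℂ) (r : ℕ) (d : ℤ) :
    pj n i f r d = if r = i ∨ (n ≤ r ∧ i = 0) then f r d else 0 := rfl

/-- Images of the generators. -/
def rg (n j : ℕ) : TGen n → Module.End ℂ (ℕ → ℤ → ℂ)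
  | .e i => pj n i
  | .a i => mv n j (i + 1) i
  | .astar i => mv n j i (i + 1)
  | .b => mv n j (n - 1) (n - 1)

lemma mv_zero (n j p q : ℕ) (h : n ≤ p ∨ n ≤ q) : mv n j p q = 0 := by
  ext f r d
  rw [mv_apply, if_neg]; · simp
  unfold V; omega

lemma pj_mv (n j p q : ℕ) : pj n p * mv n j p q = mv n j p q := by
  ext f r d
  simp only [Module.End.mul_apply, pj_apply, mv_apply]
  split_ifs <;> first | rfl | omega

lemma mv_pj (n j p q : ℕ) : mv n j p q * pj n q = mv n j p q := by
  ext f r d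
  simp only [Module.End.mul_apply, pj_apply, mv_apply]
  split_ifs <;> first | rfl | tauto

lemma rg_rel (n j : ℕ) (hj : j < n) ⦃x y : F n⦄ (h : TRel n x y) :
    FreeAlgebra.lift ℂ (rg n j) x = FreeAlgebra.lift ℂ (rg n j) y := by
  cases h with
  | idem i k =>
    by_cases hik : i = k
    · subst hik
      simp only [g, map_mul, FreeAlgebra.lift_ι_apply, rg, if_true]
      ext f r d
      simp only [Module.End.mul_apply, pj_apply]
      split_ifs <;> rfl
    · simp only [g, map_mul, FreeAlgebra.lift_ι_apply, rg, if_neg hik, map_zero]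
      ext f r d
      have : (i : ℕ) ≠ k := fun h => hik (Fin.ext h)
      have := i.2
      have := k.2
      simp only [Module.End.mul_apply, pj_apply]
      split_ifs <;> first | rfl | omega
  | sum_idem =>
    simp only [g, map_sum, FreeAlgebra.lift_ι_apply, rg, map_one]
    ext f r d
    simp only [LinearMap.sum_apply, Finset.sum_apply, pj_apply, Module.End.one_apply]
    by_cases hr : r < n
    · rw [Finset.sum_eq_single (⟨r, hr⟩ : Fin n)]
      · simp
      · intro k _ hk
        have : (k : ℕ) ≠ r := fun h => hk (Fin.ext h)
        rw [if_neg]; omega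
      · simp
    · rw [Finset.sum_eq_single (⟨0, by omega⟩ : Fin n)]
      · rw [if_pos]; simp; omega
      · intro k _ hk
        have : (k : ℕ) ≠ 0 := fun h => hk (Fin.ext h)
        have := k.2
        rw [if_neg]; omega
      · simp
  | a_path i h =>
    simp only [g, map_mul, FreeAlgebra.lift_ι_apply, rg]
    rw [pj_mv, mv_pj]
  | a_junk i h =>
    simp only [g, FreeAlgebra.lift_ι_apply, rg, map_zero]
    exact mv_zero _ _ _ _ (by omega)
  | astar_path i h =>
    simp only [g, map_mul, FreeAlgebra.lift_ι_apply, rg]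
    rw [pj_mv, mv_pj]
  | astar_junk i h =>
    simp only [g, FreeAlgebra.lift_ι_apply, rg, map_zero]
    exact mv_zero _ _ _ _ (by omega)
  | b_path i h =>
    simp only [g, map_mul, FreeAlgebra.lift_ι_apply, rg]
    have : (i : ℕ) = n - 1 := by omega
    rw [this, pj_mv, mv_pj]
  | preproj =>
    simp only [g, map_mul, map_sum, map_sub, FreeAlgebra.lift_ι_apply, rg]
    ext f r d
    simp only [LinearMap.sum_apply, Finset.sum_apply, LinearMap.sub_apply, Pi.sub_apply,
      Module.End.mul_apply, Finset.sum_sub_distrib]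
    have h1 : ∑ i : Fin n, mv n j (i + 1) i (mv n j i (i + 1) f) r d =
        if 1 ≤ r ∧ V n j r d ∧ V n j (r - 1) (d - 1) ∧ V n j r (d - 1 - 1)
        then f r (d - 1 - 1) else 0 := by
      by_cases hr : 1 ≤ r ∧ r < n
      · obtain ⟨r, rfl⟩ : ∃ k, r = k + 1 := ⟨r - 1, by omega⟩
        rw [Finset.sum_eq_single (⟨r, by omega⟩ : Fin n)]
        · simp only [mv_apply]
          push_cast
          simp only [add_sub_cancel_right]
          split_ifs <;> first | rfl | tauto
        · intro k _ hk
          have : (k : ℕ) ≠ r := fun h => hk (Fin.ext h)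
          rw [mv_apply, if_neg]; omega
        · simp
      · rw [if_neg (by unfold V; omega)]
        refine Finset.sum_eq_zero fun k _ => ?_
        rw [mv_apply, if_neg]; unfold V; omega
    have h2 : ∑ i : Fin n, mv n j i (i + 1) (mv n j (i + 1) i f) r d =
        if V n j r d ∧ V n j (r + 1) (d - 1) ∧ V n j r (d - 1 - 1)
        then f r (d - 1 - 1) else 0 := by
      by_cases hr : r < n
      · rw [Finset.sum_eq_single (⟨r, by omega⟩ : Fin n)]
        · simp only [mv_apply]
          push_cast
          split_ifs <;> first | rfl | tauto
        · intro k _ hk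
          have : (k : ℕ) ≠ r := fun h => hk (Fin.ext h)
          rw [mv_apply, if_neg]; omega
        · simp
      · rw [if_neg (by unfold V; omega)]
        refine Finset.sum_eq_zero fun k _ => ?_
        rw [mv_apply, if_neg]; unfold V; omega
    have h3 : mv n j (n - 1) (n - 1) (mv n j (n - 1) (n - 1) f) r d =
        if r + 1 = n ∧ V n j r d ∧ V n j r (d - 1) ∧ V n j r (d - 1 - 1)
        then f r (d - 1 - 1) else 0 := by
      simp only [mv_apply]
      by_cases hr : r + 1 = n
      · have : n - 1 = r := by omega
        rw [this]
        split_ifs <;> first | rfl | tauto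
      · rw [if_neg (by omega), if_neg (by omega)]
    rw [h1, h2, h3]
    by_cases hV : V n j r d ∧ V n j r (d - 1 - 1)
    · obtain ⟨hV1, hV2⟩ := hV
      have hr1 : 1 ≤ r ∧ V n j (r - 1) (d - 1) := by
        unfold V at hV1 hV2 ⊢; omega
      by_cases hr : r + 1 = n
      · have hb : V n j r (d - 1) := by
          unfold V at hV1 hV2 ⊢; omega
        have hc : ¬ V n j (r + 1) (d - 1) := by unfold V; omega
        simp [hV1, hV2, hr1, hr, hb, hc]
      · have hc : V n j (r + 1) (d - 1) := by
          unfold V at hV1 hV2 ⊢; omega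
        simp [hV1, hV2, hr1, hr, hc]
    · rw [if_neg (by tauto), if_neg (by tauto), if_neg (by tauto)]; simp

/-- The representation on (a space containing) the projective `A e_j`. -/
noncomputable def rho (n j : ℕ) (hj : j < n) : PiT n →ₐ[ℂ] Module.End ℂ (ℕ → ℤ → ℂ) :=
  RingQuot.liftAlgHom ℂ ⟨FreeAlgebra.lift ℂ (rg n j), rg_rel n j hj⟩

lemma rho_gen (n j : ℕ) (hj : j < n) (t : TGen n) : rho n j hj (gen t) = rg n j t := by
  simp [rho, gen, g]

lemma rho_up {n j : ℕ} (hj : j < n) (f : ℕ → ℤ → ℂ) (r : ℕ) (d : ℤ)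
    (h1 : V n j r d) (h2 : V n j (r + 1) (d + 1)) :
    rho n j hj (up n) f (r + 1) (d + 1) = f r d := by
  have hr : r < n := by unfold V at h1; omega
  rw [up, map_sum]
  simp only [rho_gen, rg, LinearMap.sum_apply, Finset.sum_apply]
  rw [Finset.sum_eq_single (⟨r, hr⟩ : Fin n)]
  · rw [mv_apply, if_pos]
    · simp
    · push_cast; simp [h1, h2]
  · intro k _ hk
    have : (k : ℕ) ≠ r := fun h => hk (Fin.ext h)
    rw [mv_apply, if_neg]; omega
  · simp

lemma rho_dn {n j : ℕ} (hj : j < n) (f : ℕ → ℤ → ℂ) (r : ℕ) (d : ℤ)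
    (h1 : V n j (r + 1) d) (h2 : V n j r (d + 1)) :
    rho n j hj (dn n) f r (d + 1) = f (r + 1) d := by
  have hr : r < n := by unfold V at h1; omega
  rw [dn, map_sum]
  simp only [rho_gen, rg, LinearMap.sum_apply, Finset.sum_apply]
  rw [Finset.sum_eq_single (⟨r, hr⟩ : Fin n)]
  · rw [mv_apply, if_pos]
    · simp
    · push_cast; simp [h1, h2]
  · intro k _ hk
    have : (k : ℕ) ≠ r := fun h => hk (Fin.ext h)
    rw [mv_apply, if_neg]; omega
  · simp

lemma rho_bb {n j : ℕ} (hj : j < n) (f : ℕ → ℤ → ℂ) (r : ℕ) (d : ℤ) (hr : r + 1 = n)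
    (h1 : V n j r d) (h2 : V n j r (d + 1)) :
    rho n j hj (bb n) f r (d + 1) = f r d := by
  obtain rfl : r = n - 1 := by omega
  rw [bb, rho_gen, rg, mv_apply, if_pos]
  · simp
  · simp [h1, h2]

/-- The socle elements. -/
noncomputable def soc (n j : ℕ) : PiT n :=
  xx n ^ j * (dn n ^ (n - 1 - j) * (bb n * up n ^ (n - 1 - j)))

lemma soc_ne {n j : ℕ} (hj : j < n) : soc n j ≠ 0 := by
  intro h0
  set f0 : ℕ → ℤ → ℂ := fun p d => if p = j ∧ d = 0 then 1 else 0 with hf0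
  have A : ∀ q : ℕ, q ≤ n - 1 - j → rho n j hj (up n ^ q) f0 (j + q) q = 1 := by
    intro q
    induction q with
    | zero => intro _; simp [hf0]
    | succ q ih =>
      intro hq
      have := ih (by omega)
      rw [pow_succ', map_mul, Module.End.mul_apply, ← this]
      push_cast
      rw [← add_assoc]
      exact rho_up hj _ _ _ (by unfold V; push_cast; omega) (by unfold V; push_cast; omega)
  set p := n - 1 - j with hp
  have B : rho n j hj (bb n * up n ^ p) f0 (n - 1) (p + 1) = 1 := by
    rw [map_mul, Module.End.mul_apply, ← A p le_rfl]
    have : j + p = n - 1 := by omega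
    rw [this]
    exact rho_bb hj _ _ _ (by omega) (by unfold V; omega) (by unfold V; omega)
  have C : ∀ q : ℕ, q ≤ p →
      rho n j hj (dn n ^ q * (bb n * up n ^ p)) f0 (n - 1 - q) (p + 1 + q) = 1 := by
    intro q
    induction q with
    | zero => intro _; simpa using B
    | succ q ih =>
      intro hq
      have := ih (by omega)
      rw [pow_succ', mul_assoc, map_mul, Module.End.mul_apply, ← this]
      push_cast
      rw [← add_assoc]
      have e : n - 1 - q = n - 1 - (q + 1) + 1 := by omega
      rw [e]
      exact rho_dn hj _ _ _ (by unfold V; omega) (by unfold V; omega)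
  have D : ∀ k : ℕ, k ≤ j →
      rho n j hj (xx n ^ k * (dn n ^ p * (bb n * up n ^ p))) f0 j (2 * p + 1 + 2 * k) = 1 := by
    intro k
    induction k with
    | zero =>
      intro _
      have := C p le_rfl
      have e : n - 1 - p = j := by omega
      rw [e] at this
      rw [← this]
      have e2 : (2 * (p : ℤ) + 1 + 2 * ((0 : ℕ) : ℤ)) = p + 1 + p := by push_cast; ring
      rw [e2, pow_zero, one_mul]
    | succ k ih =>
      intro hk
      have := ih (by omega)
      rw [pow_succ', mul_assoc, map_mul, Module.End.mul_apply, ← this]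
      obtain ⟨r, hr⟩ : ∃ r, j = r + 1 := ⟨j - 1, by omega⟩
      have e : (2 * (p : ℤ) + 1 + 2 * ((k + 1 : ℕ) : ℤ)) = (2 * p + 1 + 2 * k + 1) + 1 := by
        push_cast; ring
      generalize (rho n j hj) (xx n ^ k * (dn n ^ p * (bb n * up n ^ p))) f0 = f
      rw [e, xx, map_mul, Module.End.mul_apply]
      have h1 := rho_up hj (rho n j hj (dn n) f) r (2 * p + 1 + 2 * k + 1)
        (by unfold V; omega) (by unfold V; omega)
      have h2 := rho_dn hj f r (2 * p + 1 + 2 * k)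
        (by unfold V; omega) (by unfold V; omega)
      rw [← hr] at h1 h2
      rw [h1, h2]
  have := D j le_rfl
  change rho n j hj (soc n j) f0 j _ = 1 at this
  rw [h0] at this
  simp at this

lemma up_pow_E {n : ℕ} (p i : ℕ) : up n ^ p * E n i = E n (i + p) * up n ^ p := by
  induction p with
  | zero => simp
  | succ p ih => rw [pow_succ', mul_assoc, ih, ← mul_assoc, up_E', mul_assoc, ← add_assoc]

lemma E_dn_pow {n : ℕ} (p i : ℕ) : E n i * dn n ^ p = dn n ^ p * E n (i + p) := by
  induction p with
  | zero => simp
  | succ p ih => rw [pow_succ, ← mul_assoc, ih, mul_assoc, ← dn_E', ← mul_assoc, ← add_assoc]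

lemma E_up_pow {n : ℕ} (i q : ℕ) :
    E n i * up n ^ q = if q ≤ i then up n ^ q * E n (i - q) else 0 := by
  split_ifs with h
  · rw [up_pow_E]; congr 2; omega
  · obtain ⟨r, rfl⟩ : ∃ r, q = r + 1 + i := ⟨q - i - 1, by omega⟩
    have := up_pow_E (n := n) i 0
    rw [zero_add] at this
    rw [pow_add, (Commute.pow_pow_self _ _ _).eq, ← mul_assoc, ← this, mul_assoc, pow_succ',
      ← mul_assoc (E n 0), E_zero_up]
    simp

lemma bb_up_pow_E {n : ℕ} (hn : 1 ≤ n) (p j : ℕ) :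
    bb n * (up n ^ p * E n j) = if j + p + 1 = n then bb n * up n ^ p else 0 := by
  rw [up_pow_E, ← mul_assoc, bb_E hn]; split_ifs <;> simp

lemma E_dn_pow_bb {n : ℕ} (hn : 1 ≤ n) (p i : ℕ) :
    E n i * (dn n ^ p * bb n) = if i + p + 1 = n then dn n ^ p * bb n else 0 := by
  rw [← mul_assoc, E_dn_pow, mul_assoc, E_bb hn]; split_ifs <;> simp

lemma xpow_comm {n : ℕ} (hn : 1 ≤ n) (k : ℕ) (z y : PiT n) :
    z * (xx n ^ k * y) = xx n ^ k * (z * y) := by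
  rw [← mul_assoc, ← ((xx_comm hn z).pow_left k).eq, mul_assoc]

lemma xpow_E {n : ℕ} (hn : 1 ≤ n) (i : ℕ) : xx n ^ (i + 1) * E n i = 0 := by
  induction i with
  | zero => simp [xx, mul_assoc, dn_E_zero]
  | succ i ih =>
    have : xx n * E n (i + 1) = up n * (E n i * dn n) := by rw [xx, mul_assoc, dn_E']
    rw [pow_succ, mul_assoc, this, ← xpow_comm hn, ← mul_assoc (xx n ^ _), ih]
    simp

/-- Normal forms of degree `d`. -/
def nfs (n d : ℕ) : Set (PiT n) :=
  {y | (∃ k p j, 2 * k + p = d ∧ y = xx n ^ k * (up n ^ p * E n j)) ∨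
    (∃ k p j, 2 * k + p = d ∧ y = xx n ^ k * (dn n ^ p * E n j)) ∨
    (∃ k p q, 2 * k + p + q + 1 = d ∧ y = xx n ^ k * (dn n ^ p * (bb n * up n ^ q)))}

/-- Span of the normal forms. -/
def nf (n d : ℕ) : Submodule ℂ (PiT n) := Submodule.span ℂ (nfs n d)

lemma nf_up {n d : ℕ} (k p j : ℕ) (h : 2 * k + p = d) :
    xx n ^ k * (up n ^ p * E n j) ∈ nf n d := Submodule.subset_span (Or.inl ⟨k, p, j, h, rfl⟩)
lemma nf_dn {n d : ℕ} (k p j : ℕ) (h : 2 * k + p = d) :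
    xx n ^ k * (dn n ^ p * E n j) ∈ nf n d :=
  Submodule.subset_span (Or.inr (Or.inl ⟨k, p, j, h, rfl⟩))
lemma nf_w {n d : ℕ} (k p q : ℕ) (h : 2 * k + p + q + 1 = d) :
    xx n ^ k * (dn n ^ p * (bb n * up n ^ q)) ∈ nf n d :=
  Submodule.subset_span (Or.inr (Or.inr ⟨k, p, q, h, rfl⟩))

lemma nf_mul_of {n d e : ℕ} (t : PiT n) (h : ∀ y ∈ nfs n d, t * y ∈ nf n e)
    {y : PiT n} (hy : y ∈ nf n d) : t * y ∈ nf n e := by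
  have : nf n d ≤ (nf n e).comap (LinearMap.mulLeft ℂ t) := Submodule.span_le.2 h
  exact this hy

lemma up_dn {n : ℕ} (y : PiT n) : up n * (dn n * y) = xx n * y := by rw [xx, mul_assoc]

lemma nf_mul_up {n d : ℕ} (hn : 1 ≤ n) {y : PiT n} (hy : y ∈ nf n d) :
    up n * y ∈ nf n (d + 1) := by
  refine nf_mul_of _ ?_ hy
  rintro y (⟨k, p, j, h, rfl⟩ | ⟨k, p, j, h, rfl⟩ | ⟨k, p, q, h, rfl⟩)
  · rw [xpow_comm hn, ← mul_assoc (up n), ← pow_succ']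
    exact nf_up _ _ _ (by omega)
  · rw [xpow_comm hn]
    rcases p with _ | p
    · have := nf_up (n := n) (d := d + 1) k 1 j (by omega)
      simpa using this
    · rw [pow_succ', mul_assoc, up_dn, ← mul_assoc, ← pow_succ]
      exact nf_dn _ _ _ (by omega)
  · rw [xpow_comm hn]
    rcases p with _ | p
    · rw [pow_zero, one_mul, ← mul_assoc (up n), up_bb hn]; simp
    · rw [pow_succ', mul_assoc, up_dn, ← mul_assoc, ← pow_succ]
      exact nf_w _ _ _ (by omega)

lemma E_up_pow_E {n : ℕ} (i p j : ℕ) :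
    E n i * (up n ^ p * E n j) = if i = j + p then up n ^ p * E n j else 0 := by
  rw [up_pow_E, ← mul_assoc, E_mul]; split_ifs with h
  · rw [h]
  · simp

lemma E_dn_pow_E {n : ℕ} (i p j : ℕ) :
    E n i * (dn n ^ p * E n j) = if i + p = j then dn n ^ p * E n j else 0 := by
  rw [← mul_assoc, E_dn_pow, mul_assoc, E_mul]; split_ifs with h
  · rw [h]
  · simp

lemma nf_mul_E {n d : ℕ} (hn : 1 ≤ n) (i : ℕ) {y : PiT n} (hy : y ∈ nf n d) :
    E n i * y ∈ nf n d := by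
  refine nf_mul_of _ ?_ hy
  rintro y (⟨k, p, j, h, rfl⟩ | ⟨k, p, j, h, rfl⟩ | ⟨k, p, q, h, rfl⟩)
  · rw [xpow_comm hn, E_up_pow_E]
    split_ifs
    · exact nf_up _ _ _ (by omega)
    · simp
  · rw [xpow_comm hn, E_dn_pow_E]
    split_ifs
    · exact nf_dn _ _ _ (by omega)
    · simp
  · rw [xpow_comm hn, ← mul_assoc (dn n ^ p), ← mul_assoc (E n i), E_dn_pow_bb hn]
    split_ifs
    · rw [mul_assoc (dn n ^ p)]; exact nf_w _ _ _ (by omega)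
    · simp

lemma nf_mul_bb {n d : ℕ} (hn : 1 ≤ n) {y : PiT n} (hy : y ∈ nf n d) :
    bb n * y ∈ nf n (d + 1) := by
  refine nf_mul_of _ ?_ hy
  have key : ∀ k p j, 2 * k + p = d → bb n * (xx n ^ k * (up n ^ p * E n j)) ∈ nf n (d + 1) := by
    intro k p j h
    rw [xpow_comm hn, bb_up_pow_E hn]
    split_ifs
    · have := nf_w (n := n) (d := d + 1) k 0 p (by omega)
      simpa using this
    · simp
  rintro y (⟨k, p, j, h, rfl⟩ | ⟨k, p, j, h, rfl⟩ | ⟨k, p, q, h, rfl⟩)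
  · exact key _ _ _ h
  · rcases p with _ | p
    · simpa using key k 0 j h
    · rw [xpow_comm hn, pow_succ', mul_assoc (dn n), ← mul_assoc (bb n), bb_dn hn]; simp
  · rw [xpow_comm hn]
    rcases p with _ | p
    · rw [pow_zero, one_mul, ← mul_assoc (bb n), bb_sq hn, mul_assoc, ← mul_assoc (xx n ^ k),
        ← pow_succ, E_up_pow]
      split_ifs
      · exact nf_up _ _ _ (by omega)
      · simp
    · rw [pow_succ', mul_assoc (dn n), ← mul_assoc (bb n), bb_dn hn]; simp

lemma nf_mul_dn {n d : ℕ} (hn : 1 ≤ n) {y : PiT n} (hy : y ∈ nf n d) :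
    dn n * y ∈ nf n (d + 1) := by
  refine nf_mul_of _ ?_ hy
  rintro y (⟨k, p, j, h, rfl⟩ | ⟨k, p, j, h, rfl⟩ | ⟨k, p, q, h, rfl⟩)
  · rw [xpow_comm hn]
    rcases p with _ | p
    · have := nf_dn (n := n) (d := d + 1) k 1 j (by omega)
      simpa using this
    · have e : dn n * up n = xx n - bb n * bb n := by rw [xx, pre]; abel
      rw [pow_succ', mul_assoc, ← mul_assoc (dn n), e, sub_mul, mul_sub]
      refine Submodule.sub_mem _ ?_ ?_
      · rw [← mul_assoc (xx n ^ k), ← pow_succ]; exact nf_up _ _ _ (by omega)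
      · rw [bb_sq hn, mul_assoc, ← mul_assoc (xx n ^ k), ← pow_succ, E_up_pow_E]
        split_ifs
        · exact nf_up _ _ _ (by omega)
        · simp
  · rw [xpow_comm hn, ← mul_assoc (dn n), ← pow_succ']
    exact nf_dn _ _ _ (by omega)
  · rw [xpow_comm hn, ← mul_assoc (dn n), ← pow_succ']
    exact nf_w _ _ _ (by omega)

lemma adeg_le_nf {n : ℕ} (hn : 1 ≤ n) (d : ℕ) : adeg n d ≤ nf n d := by
  refine Submodule.span_le.2 ?_
  rintro y ⟨l, hl, rfl⟩
  induction l generalizing d with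
  | nil =>
    simp only [List.map_nil, List.sum_nil] at hl
    subst hl
    simp only [List.map_nil, List.prod_nil]
    rw [← E_sum]
    refine Submodule.sum_mem _ fun i _ => ?_
    simpa using nf_up (n := n) (d := 0) 0 0 i (by omega)
  | cons t l ih =>
    simp only [List.map_cons, List.sum_cons] at hl
    simp only [List.map_cons, List.prod_cons]
    subst hl
    have := ih _ rfl
    cases t with
    | e i =>
      rw [← E_fin, wt, zero_add]; exact nf_mul_E hn _ this
    | a i =>
      rw [gen_a_eq, wt, add_comm, mul_assoc]
      · exact nf_mul_up hn (nf_mul_E hn _ this)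
      · simp
    | astar i =>
      rw [gen_s_eq, wt, add_comm, mul_assoc]
      · exact nf_mul_dn hn (nf_mul_E hn _ this)
      · simp
    | b =>
      rw [wt, add_comm]
      · exact nf_mul_bb hn this
      · simp

lemma adeg_mul {n d e : ℕ} {y z : PiT n} (hy : y ∈ adeg n d) (hz : z ∈ adeg n e) :
    y * z ∈ adeg n (d + e) := by
  have := Submodule.mul_mem_mul hy hz
  rw [adeg, adeg, Submodule.span_mul_span] at this
  refine Submodule.span_mono ?_ this
  rintro _ ⟨_, ⟨l, hl, rfl⟩, _, ⟨l', hl', rfl⟩, rfl⟩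
  exact ⟨l ++ l', by simp [hl, hl'], by simp⟩

lemma adeg_gen {n : ℕ} (t : TGen n) : gen t ∈ adeg n (wt t) :=
  Submodule.subset_span ⟨[t], by simp, by simp⟩

lemma adeg_one {n : ℕ} : (1 : PiT n) ∈ adeg n 0 :=
  Submodule.subset_span ⟨[], by simp, by simp⟩

lemma adeg_xx {n : ℕ} (k : ℕ) : xx n ^ k ∈ adeg n (2 * k) := by
  induction k with
  | zero => simpa using adeg_one
  | succ k ih =>
    rw [pow_succ]
    refine adeg_mul ih (adeg_mul (d := 1) (e := 1) ?_ ?_)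
    · rw [up]; exact Submodule.sum_mem _ fun i _ => adeg_gen (.a i)
    · rw [dn]; exact Submodule.sum_mem _ fun i _ => adeg_gen (.astar i)

/-- The diagonal normal form. -/
noncomputable def Y (n i d : ℕ) : PiT n :=
  if d % 2 = 0 then xx n ^ (d / 2) * E n i else
    if n - 1 - i ≤ d / 2 then
      xx n ^ (d / 2 - (n - 1 - i)) * (dn n ^ (n - 1 - i) * (bb n * up n ^ (n - 1 - i))) else 0

lemma diag {n d : ℕ} (hn : 1 ≤ n) (i : ℕ) {y : PiT n} (hy : y ∈ nf n d) :
    ∃ c : ℂ, E n i * y * E n i = c • Y n i d := by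
  have : nf n d ≤ (Submodule.span ℂ {Y n i d}).comap
      ((LinearMap.mulRight ℂ (E n i)).comp (LinearMap.mulLeft ℂ (E n i))) := by
    refine Submodule.span_le.2 ?_
    intro y hy
    simp only [Submodule.comap_coe, Set.mem_preimage, LinearMap.comp_apply,
      LinearMap.mulLeft_apply, LinearMap.mulRight_apply, SetLike.mem_coe]
    rcases hy with (⟨k, p, j, h, rfl⟩ | ⟨k, p, j, h, rfl⟩ | ⟨k, p, q, h, rfl⟩)
    · rw [xpow_comm hn, E_up_pow_E]
      split_ifs with hi
      · rw [mul_assoc, mul_assoc, E_mul]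
        split_ifs with hj
        · obtain rfl : p = 0 := by omega
          have : xx n ^ k * (up n ^ 0 * E n j) = Y n i d := by
            rw [Y, if_pos (by omega), hj]; simp; congr 2; omega
          rw [this]; exact Submodule.mem_span_singleton_self _
        · simp
      · simp
    · rw [xpow_comm hn, E_dn_pow_E]
      split_ifs with hi
      · rw [mul_assoc, mul_assoc, E_mul]
        split_ifs with hj
        · obtain rfl : p = 0 := by omega
          have : xx n ^ k * (dn n ^ 0 * E n j) = Y n i d := by
            rw [Y, if_pos (by omega), hj]; simp; congr 2; omega
          rw [this]; exact Submodule.mem_span_singleton_self _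
        · simp
      · simp
    · rw [xpow_comm hn, ← mul_assoc (dn n ^ p), ← mul_assoc (E n i), E_dn_pow_bb hn]
      split_ifs with hi
      · rw [mul_assoc, mul_assoc, mul_assoc, bb_up_pow_E hn]
        split_ifs with hj
        · have hp : p = n - 1 - i := by omega
          have hq : q = n - 1 - i := by omega
          have : xx n ^ k * (dn n ^ p * (bb n * up n ^ q)) = Y n i d := by
            rw [Y, if_neg (by omega), if_pos (by omega), hp, hq]; congr 2; omega
          rw [this]; exact Submodule.mem_span_singleton_self _
        · simp
      · simp
  obtain ⟨c, hc⟩ := Submodule.mem_span_singleton.1 (this hy)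
  exact ⟨c, hc.symm⟩

lemma central_diag {n d : ℕ} (hn : 1 ≤ n) (i : ℕ) {z : PiT n} (hc : ∀ y, y * z = z * y)
    (hz : z ∈ adeg n d) : ∃ c : ℂ, E n i * z = c • Y n i d := by
  obtain ⟨c, h⟩ := diag hn i (adeg_le_nf hn d hz)
  refine ⟨c, ?_⟩
  rw [← h, mul_assoc, ← hc, ← mul_assoc, E_self]

lemma eq_zero_of_E {n : ℕ} {z : PiT n} (h : ∀ i < n, E n i * z = 0) : z = 0 := by
  rw [← one_mul z, ← E_sum, Finset.sum_mul]
  exact Finset.sum_eq_zero fun i hi => h i (Finset.mem_range.1 hi)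

lemma soc_E {n j : ℕ} (hn : 1 ≤ n) (hj : j < n) : soc n j * E n j = soc n j := by
  rw [soc, mul_assoc, mul_assoc, mul_assoc, bb_up_pow_E hn, if_pos (by omega)]

lemma odd_zero {n m : ℕ} (hn : 1 ≤ n) (hm : m < n - 1) {z : PiT n} (hc : ∀ y, y * z = z * y)
    (hz : z ∈ adeg n (2 * m + 1)) : z = 0 := by
  refine eq_zero_of_E fun i => ?_
  induction i with
  | zero =>
    intro _
    obtain ⟨c, h⟩ := central_diag hn 0 hc hz
    rw [h, Y, if_neg (by omega), if_neg (by omega), smul_zero]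
  | succ i ih =>
    intro hi
    obtain ⟨c, h⟩ := central_diag hn (i + 1) hc hz
    have h0 : E n (i + 1) * z * up n * E n i = 0 := by
      rw [mul_assoc _ z, ← hc, ← mul_assoc, ← up_E', mul_assoc, ← hc, mul_assoc,
        ← mul_assoc (E n i), E_self, ih (by omega), mul_zero]
    rw [h, Y, if_neg (by omega)] at h0 ⊢
    split_ifs at h0 ⊢ with hp
    · have hk : (2 * m + 1) / 2 = m := by omega
      rw [hk] at h0 hp ⊢
      set p := n - 1 - (i + 1) with hpd
      have h1 : xx n ^ (n - 2 - m) * (dn n * ((c • (xx n ^ (m - p) *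
          (dn n ^ p * (bb n * up n ^ p)))) * up n * E n i)) = c • soc n i := by
        rw [smul_mul_assoc, smul_mul_assoc, mul_smul_comm, mul_smul_comm]
        congr 1
        rw [mul_assoc, mul_assoc, xpow_comm hn, ← mul_assoc (xx n ^ _), ← pow_add]
        have e1 : n - 2 - m + (m - p) = i := by omega
        have e2 : n - 1 - i = p + 1 := by omega
        rw [e1, ← soc_E hn (by omega : i < n), soc, e2]
        simp only [mul_assoc, pow_succ' (dn n), pow_succ (up n)]
      rw [h0, mul_zero, mul_zero] at h1
      have := (smul_eq_zero.1 h1.symm).resolve_right (soc_ne (by omega))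
      rw [this, zero_smul]
    · simp

lemma even_zero {n k : ℕ} (hn : 1 ≤ n) {z : PiT n} (hc : ∀ y, y * z = z * y)
    (hz : z ∈ adeg n (2 * k)) (hl : E n (n - 1) * z = 0) : z = 0 := by
  have key : ∀ m, m < n → E n (n - 1 - m) * z = 0 := by
    intro m
    induction m with
    | zero => intro _; simpa using hl
    | succ m ih =>
      intro hm
      have ih := ih (by omega)
      obtain ⟨i, hi⟩ : ∃ i, n - 1 - m = i + 1 := ⟨n - 2 - m, by omega⟩
      have hi' : n - 1 - (m + 1) = i := by omega
      rw [hi] at ih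
      rw [hi']
      obtain ⟨c, h⟩ := central_diag hn i hc hz
      have h0 : up n * (E n i * z) = 0 := by
        rw [← mul_assoc, up_E', mul_assoc, hc, ← mul_assoc, ih, zero_mul]
      have hk : 2 * k / 2 = k := by omega
      rw [h, Y, if_pos (by omega), hk] at h0 ⊢
      by_cases hki : k ≤ i
      · obtain ⟨p, hp⟩ : ∃ p, n - 1 - i = p + 1 := ⟨n - 2 - i, by omega⟩
        have h1 : xx n ^ (i - k) * (dn n ^ (p + 1) * (bb n * (up n ^ p *
            (up n * (c • (xx n ^ k * E n i)))))) = c • soc n i := by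
          simp only [mul_smul_comm]
          congr 1
          rw [← mul_assoc (up n ^ p), ← pow_succ]
          rw [xpow_comm hn k (up n ^ (p + 1)), xpow_comm hn k (bb n), xpow_comm hn k (dn n ^ (p + 1))]
          rw [← mul_assoc (xx n ^ _), ← pow_add]
          have e1 : k + (i - k) = i := by omega
          have e1' : i - k + k = i := by omega
          rw [← soc_E hn (by omega : i < n), soc, hp]
          simp only [mul_assoc, e1, e1']
        rw [h0] at h1
        simp only [mul_zero] at h1
        have := (smul_eq_zero.1 h1.symm).resolve_right (soc_ne (by omega))
        rw [this, zero_smul]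
      · obtain ⟨r, rfl⟩ : ∃ r, k = r + (i + 1) := ⟨k - (i + 1), by omega⟩
        rw [pow_add, mul_assoc, xpow_E hn]; simp
  refine eq_zero_of_E fun i hi => ?_
  have := key (n - 1 - i) (by omega)
  rwa [show n - 1 - (n - 1 - i) = i by omega] at this

lemma xpow_ne {n k : ℕ} (hn : 1 ≤ n) (hk : k ≤ n - 1) : xx n ^ k ≠ 0 := by
  intro h
  apply soc_ne (n := n) (j := n - 1) (by omega)
  rw [soc, ← Nat.sub_add_cancel hk, pow_add, h]; simp

end TPre

/-- **Theorem (Hilbert series of `U`).**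
The graded vector space `U = ⊕_{d<h-2} HH^0(A)(d)[2]` — realized as the part of the
center `HH^0(A)` of `A = Π_{T_n}` lying below the top degree `h - 2 = 2n - 1` — has
Hilbert series `∑_{i=0}^{n-1} t^{2i}`: in each degree `d < h - 2` the center of `A`
is one-dimensional if `d` is even and zero if `d` is odd.  In particular `U` is
`n`-dimensional with exactly one basis element in each even degree `0, 2, …, 2(n-1)`. -/
theorem hilbert_series_of_U (n : ℕ) (hn : 1 ≤ n) :
    ∀ d : ℕ, d < 2 * n - 1 →
      Module.finrank ℂ
          ↥((Subalgebra.center ℂ (PiT n)).toSubmodule ⊓ adeg n d)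
        = if Even d then 1 else 0 := by
  intro d hd
  have hcen : ∀ z : PiT n, z ∈ (Subalgebra.center ℂ (PiT n)).toSubmodule ↔
      ∀ y, y * z = z * y := by
    intro z
    rw [Subalgebra.mem_toSubmodule, Subalgebra.mem_center_iff]
  split_ifs with he
  · obtain ⟨k, hk⟩ := he
    obtain rfl : d = 2 * k := by omega
    have hx : ∀ y, y * xx n ^ k = xx n ^ k * y := fun y => ((xx_comm hn y).pow_left k).eq.symm
    have : (Subalgebra.center ℂ (PiT n)).toSubmodule ⊓ adeg n (2 * k)
        = Submodule.span ℂ {xx n ^ k} := by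
      refine le_antisymm ?_ ?_
      · rintro z ⟨h1, h2⟩
        have h1 := (hcen z).1 h1
        obtain ⟨c, h⟩ := central_diag hn (n - 1) h1 h2
        rw [Y, if_pos (by omega), show 2 * k / 2 = k by omega] at h
        have h0 : z - c • xx n ^ k = 0 := by
          refine even_zero hn (k := k) ?_ ?_ ?_
          · intro y
            rw [mul_sub, sub_mul, h1, mul_smul_comm, smul_mul_assoc, hx]
          · exact Submodule.sub_mem _ h2 (Submodule.smul_mem _ _ (adeg_xx k))
          · rw [mul_sub, h, mul_smul_comm, hx, sub_self]
        exact Submodule.mem_span_singleton.2 ⟨c, (sub_eq_zero.1 h0).symm⟩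
      · rw [Submodule.span_singleton_le_iff_mem]
        exact ⟨(hcen _).2 hx, adeg_xx k⟩
    rw [this]
    exact finrank_span_singleton (xpow_ne hn (by omega))
  · obtain ⟨m, rfl⟩ := Nat.not_even_iff_odd.1 he
    have : (Subalgebra.center ℂ (PiT n)).toSubmodule ⊓ adeg n (2 * m + 1) = ⊥ := by
      rw [eq_bot_iff]
      rintro z ⟨h1, h2⟩
      exact (Submodule.mem_bot ℂ).2 (odd_zero hn (by omega) ((hcen z).1 h1) h2)
    rw [this]
    exact finrank_bot ℂ _
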